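/- (Lemma 1) In the SquaredEquality formulas every outer resolvent on a universal literal is a tautology: for every n, every literal ℓ whose variable is u_i or v_j for some i, j ∈ [n], and all clauses E, F of eq²(n) with ℓ ∈ E and the negation ℓ̄ ∈ F, the outer resolvent (E \ {ℓ}) ∪ { k ∈ F \ {ℓ̄} : the variable of k is not of the form T a b } contains a complementary pair of literals (namely x_i and ¬x_i when the variable of ℓ is u_i, and y_j and ¬y_j when it is v_j), and hence is satisfied by every assignment α : V(n) → Bool. -/

import Mathlib

/-- Variables of `EQ²(n)`: `X i`, `Y i` (outer existential), `U i`, `W i`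
(universal; `W` encodes the `v`-variables) and `T i j` (inner existential). -/
inductive V (n : ℕ) : Type where
  | X : Fin n → V n
  | Y : Fin n → V n
  | U : Fin n → V n
  | W : Fin n → V n
  | T : Fin n → Fin n → V n
  deriving DecidableEq

/-- A literal is a variable together with a polarity. -/
abbrev Lit (n : ℕ) := V n × Bool

/-- The clause `C_{i,j} = {x_i, y_j, u_i, v_j, t_{i,j}}`. -/
def Cc (n : ℕ) (i j : Fin n) : Finset (Lit n) :=
  {(V.X i, true), (V.Y j, true), (V.U i, true), (V.W j, true), (V.T i j, true)}

/-- The clause `C'_{i,j} = {x_i, ¬y_j, u_i, ¬v_j, t_{i,j}}`. -/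
def Cc' (n : ℕ) (i j : Fin n) : Finset (Lit n) :=
  {(V.X i, true), (V.Y j, false), (V.U i, true), (V.W j, false), (V.T i j, true)}

/-- The clause `D_{i,j} = {¬x_i, y_j, ¬u_i, v_j, t_{i,j}}`. -/
def Dc (n : ℕ) (i j : Fin n) : Finset (Lit n) :=
  {(V.X i, false), (V.Y j, true), (V.U i, false), (V.W j, true), (V.T i j, true)}

/-- The clause `D'_{i,j} = {¬x_i, ¬y_j, ¬u_i, ¬v_j, t_{i,j}}`. -/
def Dc' (n : ℕ) (i j : Fin n) : Finset (Lit n) :=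
  {(V.X i, false), (V.Y j, false), (V.U i, false), (V.W j, false), (V.T i j, true)}

/-- The clause `T = {¬t_{i,j} : i, j ∈ [n]}`. -/
def Tcl (n : ℕ) : Finset (Lit n) :=
  Finset.univ.image (fun p : Fin n × Fin n => ((V.T p.1 p.2 : V n), false))

/-- The SquaredEquality matrix `eq²(n)` as a finite set of clauses. -/
def eq2 (n : ℕ) : Finset (Finset (Lit n)) :=
  (Finset.univ.image fun p : Fin n × Fin n => Cc n p.1 p.2) ∪
  (Finset.univ.image fun p : Fin n × Fin n => Cc' n p.1 p.2) ∪
  (Finset.univ.image fun p : Fin n × Fin n => Dc n p.1 p.2) ∪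
  (Finset.univ.image fun p : Fin n × Fin n => Dc' n p.1 p.2) ∪
  {Tcl n}

/-- Negation of a literal. -/
def negLit {n : ℕ} (ℓ : Lit n) : Lit n := (ℓ.1, !ℓ.2)

/-- Whether a variable is a `t`-variable (level 3, to the right of the universal
variables in the prefix of `EQ²(n)`). -/
def V.isT {n : ℕ} : V n → Bool
  | V.T _ _ => true
  | _ => false

/-- The outer resolvent on a universal literal `ℓ ∈ E` with `ℓ̄ ∈ F`: all literals of
`E \ {ℓ}` together with the literals of `F \ {ℓ̄}` occurring to the left of `ℓ`,
i.e. those whose variable is not a `t`-variable. -/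
def outerRes {n : ℕ} (E F : Finset (Lit n)) (ℓ : Lit n) : Finset (Lit n) :=
  E.erase ℓ ∪ (F.erase (negLit ℓ)).filter (fun k => k.1.isT = false)

theorem eq2_UX {n : ℕ} {E : Finset (Lit n)} (hE : E ∈ eq2 n) (i : Fin n) (b : Bool)
    (h : ((V.U i : V n), b) ∈ E) : ((V.X i : V n), b) ∈ E := by
  simp only [eq2, Finset.mem_union, Finset.mem_image, Finset.mem_singleton] at hE
  rcases hE with (((⟨p, -, rfl⟩ | ⟨p, -, rfl⟩) | ⟨p, -, rfl⟩) | ⟨p, -, rfl⟩) | rfl <;>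
    simp_all [Cc, Cc', Dc, Dc', Tcl]

theorem eq2_WY {n : ℕ} {E : Finset (Lit n)} (hE : E ∈ eq2 n) (i : Fin n) (b : Bool)
    (h : ((V.W i : V n), b) ∈ E) : ((V.Y i : V n), b) ∈ E := by
  simp only [eq2, Finset.mem_union, Finset.mem_image, Finset.mem_singleton] at hE
  rcases hE with (((⟨p, -, rfl⟩ | ⟨p, -, rfl⟩) | ⟨p, -, rfl⟩) | ⟨p, -, rfl⟩) | rfl <;>
    simp_all [Cc, Cc', Dc, Dc', Tcl]

/-- Lemma 1: in the SquaredEquality formulas every outer resolvent on a universal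
literal is a tautology — it contains a complementary pair of literals (`x_i` and `¬x_i`
when the variable of `ℓ` is `u_i`, and `y_j` and `¬y_j` when it is `v_j`), and hence is
satisfied by every assignment. -/
theorem outer_resolvent_tautology (n : ℕ) (ℓ : Lit n)
    (hℓ : (∃ i : Fin n, ℓ.1 = V.U i) ∨ (∃ j : Fin n, ℓ.1 = V.W j))
    (E F : Finset (Lit n)) (hE : E ∈ eq2 n) (hF : F ∈ eq2 n)
    (hℓE : ℓ ∈ E) (hℓF : negLit ℓ ∈ F) :
    (∀ i : Fin n, ℓ.1 = V.U i →
        ((V.X i : V n), true) ∈ outerRes E F ℓ ∧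
        ((V.X i : V n), false) ∈ outerRes E F ℓ) ∧
    (∀ j : Fin n, ℓ.1 = V.W j →
        ((V.Y j : V n), true) ∈ outerRes E F ℓ ∧
        ((V.Y j : V n), false) ∈ outerRes E F ℓ) ∧
    (∀ α : V n → Bool, ∃ k ∈ outerRes E F ℓ, α k.1 = k.2) := by
  obtain ⟨w, b⟩ := ℓ
  have hU : ∀ i : Fin n, w = V.U i →
      ((V.X i : V n), true) ∈ outerRes E F (w, b) ∧
      ((V.X i : V n), false) ∈ outerRes E F (w, b) := by
    rintro i rfl
    have h1 := eq2_UX hE i _ hℓE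
    have h2 := eq2_UX hF i _ hℓF
    cases b <;> simp_all [outerRes, negLit, V.isT]
  have hW : ∀ i : Fin n, w = V.W i →
      ((V.Y i : V n), true) ∈ outerRes E F (w, b) ∧
      ((V.Y i : V n), false) ∈ outerRes E F (w, b) := by
    rintro i rfl
    have h1 := eq2_WY hE i _ hℓE
    have h2 := eq2_WY hF i _ hℓF
    cases b <;> simp_all [outerRes, negLit, V.isT]
  refine ⟨hU, hW, fun α => ?_⟩
  rcases hℓ with ⟨i, hi⟩ | ⟨i, hi⟩
  · obtain ⟨h1, h2⟩ := hU i hi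
    cases h : α (V.X i)
    · exact ⟨_, h2, h⟩
    · exact ⟨_, h1, h⟩
  · obtain ⟨h1, h2⟩ := hW i hi
    cases h : α (V.Y i)
    · exact ⟨_, h2, h⟩
    · exact ⟨_, h1, h⟩
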